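/- arXiv:1411.0537 — 4 statements merged into one kernel-verified Lean document; each statement's English description precedes it below -/
import Mathlib

section
/- Let G be a finite simple graph with vertex set V. If G admits an admissible weight system, then G is an iterated cone over a discrete set: there exists a subset I ⊆ V that is an independent set of G such that every vertex not in I is adjacent in G to every other vertex of G. -/
/-- A subset `S` of the vertices of a simple graph `G` is a *tube* if the
subgraph of `G` induced on `S` is (nonempty and) connected. -/
def IsTube {V : Type*} (G : SimpleGraph V) (S : Finset V) : Prop :=
  (G.induce (S : Set V)).Connected

/-- A subset `D` of the vertices of a simple graph `G` is a *non-tube* if `D`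
is nonempty and the subgraph of `G` induced on `D` is not connected. -/
def IsNonTube {V : Type*} (G : SimpleGraph V) (D : Finset V) : Prop :=
  D.Nonempty ∧ ¬ (G.induce (D : Set V)).Connected

/-- An *admissible weight system* for `G` is a pair `(c₀, c)` with values in
`(0,1]` such that (W1) for every nontrivial tube `T`, `c₀ + ∑_{v ∈ T} c v > 1`,
and (W2) for every non-tube `D`, `c₀ + ∑_{v ∈ D} c v ≤ 1`. -/
def IsAdmissible {V : Type*} (G : SimpleGraph V) (c₀ : ℝ) (c : V → ℝ) : Prop :=
  (0 < c₀ ∧ c₀ ≤ 1) ∧ (∀ v, 0 < c v ∧ c v ≤ 1) ∧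
  (∀ T : Finset V, IsTube G T → 2 ≤ T.card → 1 < c₀ + ∑ v ∈ T, c v) ∧
  (∀ D : Finset V, IsNonTube G D → c₀ + ∑ v ∈ D, c v ≤ 1)

theorem isNonTube_of_isolated {V : Type*} {G : SimpleGraph V} {D : Finset V} {x y : V}
    (hx : x ∈ D) (hy : y ∈ D) (hxy : x ≠ y) (hD : ∀ z ∈ D, ¬ G.Adj x z) : IsNonTube G D := by
  refine ⟨⟨x, hx⟩, fun hc ↦ ?_⟩
  obtain ⟨p⟩ := hc.preconnected ⟨x, hx⟩ ⟨y, hy⟩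
  cases p with
  | nil => exact hxy rfl
  | cons hadj _ => exact hD _ (Subtype.property _) hadj

theorem isTube_pair {V : Type*} [DecidableEq V] {G : SimpleGraph V} {u v : V}
    (huv : G.Adj u v) : IsTube G {u, v} := by
  unfold IsTube
  rw [Finset.coe_pair]
  exact SimpleGraph.induce_pair_connected_of_adj huv

namespace IsAdmissible

variable {V : Type*} {G : SimpleGraph V} {c₀ : ℝ} {c : V → ℝ}

theorem one_lt_of_adj (h : IsAdmissible G c₀ c) {u v : V} (huv : G.Adj u v) :
    1 < c₀ + (c u + c v) := by
  classical
  rw [← Finset.sum_pair huv.ne]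
  exact h.2.2.1 _ (isTube_pair huv) (Finset.card_pair huv.ne).ge

theorem le_one_of_not_adj (h : IsAdmissible G c₀ c) {u v : V} (hne : u ≠ v)
    (huv : ¬ G.Adj u v) : c₀ + (c u + c v) ≤ 1 := by
  classical
  rw [← Finset.sum_pair hne]
  exact h.2.2.2 _ (isNonTube_of_isolated (x := u) (y := v) (by simp) (by simp) hne (by simp [huv]))

/-- No vertex is non-adjacent to both ends of an edge not containing it. -/
theorem adj_of_not_adj (h : IsAdmissible G c₀ c) {u v w : V} (huv : G.Adj u v)
    (hwu : w ≠ u) (hadj : ¬ G.Adj u w) : G.Adj v w := by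
  classical
  by_contra hvw
  have hwv : w ≠ v := by rintro rfl; exact hadj huv
  have hle := h.2.2.2 {w, u, v} (isNonTube_of_isolated (x := w) (y := u) (by simp) (by simp) hwu
    (by simp [G.adj_comm w, hadj, hvw]))
  rw [Finset.sum_insert (by simp [hwu, hwv]), Finset.sum_pair huv.ne] at hle
  linarith [h.one_lt_of_adj huv, (h.2.1 w).1]

end IsAdmissible

/-- If a finite simple graph admits an admissible weight system, then it is an
iterated cone over a discrete set: there is an independent set `I` such that
every vertex not in `I` is adjacent to every other vertex. -/
theorem iteratedCone_of_admissible {V : Type*} [Fintype V]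
    (G : SimpleGraph V) (c₀ : ℝ) (c : V → ℝ) (h : IsAdmissible G c₀ c) :
    ∃ I : Set V, (∀ u ∈ I, ∀ v ∈ I, ¬ G.Adj u v) ∧
      (∀ v ∉ I, ∀ w, w ≠ v → G.Adj v w) := by
  refine ⟨{v | ∃ w, w ≠ v ∧ ¬ G.Adj v w}, ?_, fun v hv w hw ↦ ?_⟩
  · rintro u ⟨u', hu, huu⟩ v ⟨v', hv, hvv⟩ huv
    have h₁ := h.one_lt_of_adj (h.adj_of_not_adj huv hu huu)
    have h₂ := h.one_lt_of_adj (h.adj_of_not_adj huv.symm hv hvv)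
    have h₃ := h.le_one_of_not_adj hu.symm huu
    have h₄ := h.le_one_of_not_adj hv.symm hvv
    linarith
  · by_contra hvw
    exact hv ⟨w, hw, hvw⟩
end

section
/- Let G be a finite simple graph whose vertex set is partitioned as V = I ⊔ C, where I is an independent set with |I| = k and every vertex of C is adjacent to every other vertex of G. Then for every real ε with 0 < ε < 1/(k+2), the assignment c₀ = 1 − (k+1)ε, c(v) = (k+2)ε for v ∈ C, and c(v) = ε for v ∈ I is an admissible weight system for G: all these values lie in (0,1], and conditions (W1) and (W2) hold. -/
/-- A connected induced subgraph on at least two vertices is not supported on an independent set. -/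
theorem IsTube.exists_notMem {V : Type*} {G : SimpleGraph V} {I T : Finset V}
    (hI : ∀ u ∈ I, ∀ v ∈ I, ¬ G.Adj u v) (hT : IsTube G T) (hcard : 2 ≤ T.card) :
    ∃ v ∈ T, v ∉ I := by
  by_contra! hTI
  obtain ⟨a, ha, b, hb, hab⟩ := Finset.one_lt_card.1 hcard
  have : Nontrivial (T : Set V) := ⟨⟨a, ha⟩, ⟨b, hb⟩, by simpa using hab⟩
  obtain ⟨w, hw⟩ := hT.preconnected.exists_adj_of_nontrivial ⟨a, ha⟩
  exact hI a (hTI a ha) w (hTI w w.2) hw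

/-- If every vertex outside `I` is adjacent to all others, then every non-tube is contained
in `I`. -/
theorem IsNonTube.subset {V : Type*} {G : SimpleGraph V} {I D : Finset V}
    (hC : ∀ v ∉ I, ∀ w, w ≠ v → G.Adj v w) (hD : IsNonTube G D) : D ⊆ I := by
  intro v hv
  by_contra hvI
  refine hD.2 ((SimpleGraph.connected_iff_exists_forall_reachable _).2 ⟨⟨v, hv⟩, fun w => ?_⟩)
  by_cases hw : w = ⟨v, hv⟩
  · rw [hw]
  · exact SimpleGraph.Adj.reachable (hC v hvI w fun h => hw (Subtype.ext h))

/-- If `G` is an iterated cone over a discrete set, with independent set `I`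
of cardinality `k` and every vertex outside `I` adjacent to every other
vertex, then for `0 < ε < 1/(k+2)` the weights `c₀ = 1 - (k+1)ε`,
`c v = (k+2)ε` for cone vertices and `c v = ε` for independent vertices form
an admissible weight system. -/
theorem admissible_of_iteratedCone {V : Type*} [Fintype V] [DecidableEq V]
    (G : SimpleGraph V) (I : Finset V)
    (hI : ∀ u ∈ I, ∀ v ∈ I, ¬ G.Adj u v)
    (hC : ∀ v ∉ I, ∀ w, w ≠ v → G.Adj v w)
    (k : ℕ) (hk : I.card = k)
    (ε : ℝ) (hε : 0 < ε) (hε' : ε < 1 / ((k : ℝ) + 2)) :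
    IsAdmissible G (1 - ((k : ℝ) + 1) * ε)
      (fun v => if v ∈ I then ε else ((k : ℝ) + 2) * ε) := by
  have hk2 : (0 : ℝ) < (k : ℝ) + 2 := by positivity
  have hlt : ((k : ℝ) + 2) * ε < 1 := by rwa [lt_div_iff₀ hk2, mul_comm] at hε'
  have hkε : 0 ≤ (k : ℝ) * ε := by positivity
  have hpos : ∀ v, 0 < if v ∈ I then ε else ((k : ℝ) + 2) * ε := fun v => by
    split_ifs <;> positivity
  refine ⟨⟨by linarith, by linarith⟩, fun v => ⟨hpos v, ?_⟩, fun T hT hcard => ?_,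
    fun D hD => ?_⟩
  · dsimp only
    split_ifs <;> linarith
  · obtain ⟨v, hvT, hvI⟩ := hT.exists_notMem hI hcard
    have hle := Finset.single_le_sum (fun u _ => (hpos u).le) hvT
    rw [if_neg hvI] at hle
    linarith
  · have hDI := hD.subset hC
    have hDk : (D.card : ℝ) ≤ k := by exact_mod_cast hk ▸ Finset.card_le_card hDI
    rw [Finset.sum_congr rfl fun v hv => if_pos (hDI hv), Finset.sum_const, nsmul_eq_mul]
    linarith [mul_le_mul_of_nonneg_right hDk hε.le]
end

section
/- Let G be a finite simple graph with vertex set V. Then G admits an admissible weight system if and only if G is an iterated cone over a discrete set, i.e., if and only if there exists an independent set I ⊆ V of G such that every vertex not in I is adjacent to every other vertex of G. -/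
namespace IsTube

variable {V : Type*} {G : SimpleGraph V} {S : Finset V}

/-- In a nontrivial tube, no vertex is isolated. -/
theorem exists_adj (hS : IsTube G S) {v w : V} (hv : v ∈ S) (hw : w ∈ S) (hvw : v ≠ w) :
    ∃ x ∈ S, G.Adj v x := by
  obtain ⟨p⟩ := hS.preconnected ⟨v, hv⟩ ⟨w, hw⟩
  cases p with
  | nil => exact absurd rfl hvw
  | @cons _ x _ h _ => exact ⟨x, x.2, h⟩

/-- A set with a vertex adjacent to all its other vertices is a tube. -/
theorem of_forall_adj {v : V} (hv : v ∈ S) (h : ∀ w ∈ S, w ≠ v → G.Adj v w) : IsTube G S := by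
  rw [IsTube, SimpleGraph.connected_iff_exists_forall_reachable]
  refine ⟨⟨v, hv⟩, fun ⟨w, hw⟩ => ?_⟩
  by_cases hwv : w = v
  · subst hwv
    exact SimpleGraph.Reachable.refl _
  · exact SimpleGraph.Adj.reachable (G := G.induce (S : Set V)) (h w hw hwv)

end IsTube

/-- A set with an isolated vertex and a further vertex is a non-tube. -/
theorem IsNonTube.of_forall_not_adj {V : Type*} {G : SimpleGraph V} {D : Finset V} {v w : V}
    (hv : v ∈ D) (hw : w ∈ D) (hvw : v ≠ w) (h : ∀ x ∈ D, ¬ G.Adj v x) : IsNonTube G D := by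
  refine ⟨⟨v, hv⟩, fun hD => ?_⟩
  obtain ⟨x, hx, hvx⟩ := IsTube.exists_adj hD hv hw hvw
  exact h x hx hvx

namespace IsAdmissible

variable {V : Type*} {G : SimpleGraph V} {c₀ : ℝ} {c : V → ℝ}

/-- Every vertex off an edge is adjacent to one of its ends. -/
theorem adj_or_adj (h : IsAdmissible G c₀ c) {u v w : V} (huv : G.Adj u v)
    (hu : w ≠ u) (hv : w ≠ v) : G.Adj u w ∨ G.Adj v w := by
  classical
  by_contra! hn
  have h₁ := h.2.2.2 {w, u, v} (IsNonTube.of_forall_not_adj (v := w) (w := u) (by simp) (by simp)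
    hu (by simp [G.adj_comm w, hn]))
  rw [Finset.sum_insert (by simp [hu, hv]), Finset.sum_pair huv.ne] at h₁
  linarith [h.one_lt_of_adj huv, (h.2.1 w).1]

end IsAdmissible

/-- A finite simple graph admits an admissible weight system if and only if it
is an iterated cone over a discrete set, i.e. there is an independent set `I`
such that every vertex not in `I` is adjacent to every other vertex. -/
theorem admissible_iff_iteratedCone {V : Type*} [Fintype V]
    (G : SimpleGraph V) :
    (∃ (c₀ : ℝ) (c : V → ℝ), IsAdmissible G c₀ c) ↔
      ∃ I : Set V, (∀ u ∈ I, ∀ v ∈ I, ¬ G.Adj u v) ∧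
        (∀ v ∉ I, ∀ w, w ≠ v → G.Adj v w) := by
  classical
  constructor
  · rintro ⟨c₀, c, h⟩
    refine ⟨{v | ∃ w, w ≠ v ∧ ¬ G.Adj v w}, ?_, ?_⟩
    · rintro u ⟨u', hu, huu'⟩ v ⟨v', hv, hvv'⟩ huv
      have hvu' : G.Adj v u' :=
        (h.adj_or_adj huv hu (by rintro rfl; exact huu' huv)).resolve_left huu'
      have huv' : G.Adj u v' :=
        (h.adj_or_adj huv (by rintro rfl; exact hvv' huv.symm) hv).resolve_right hvv'
      linarith [h.one_lt_of_adj hvu', h.one_lt_of_adj huv', h.le_one_of_not_adj hu.symm huu',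
        h.le_one_of_not_adj hv.symm hvv']
    · intro v hv w hw
      by_contra hvw
      exact hv ⟨w, hw, hvw⟩
  · rintro ⟨I, hI, hC⟩
    have hn : (0 : ℝ) < 2 * (Fintype.card V + 1) := by positivity
    have hc : ∀ v, 0 < (if v ∈ I then 1 / (2 * (Fintype.card V + 1)) else 1 : ℝ) := by
      intro v
      split_ifs <;> positivity
    refine ⟨1 / 2, fun v => if v ∈ I then 1 / (2 * (Fintype.card V + 1)) else 1,
      by norm_num, fun v => ⟨hc v, ?_⟩, ?_, ?_⟩
    · dsimp only
      split_ifs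
      · rw [div_le_one hn]
        linarith [(Nat.cast_nonneg (Fintype.card V) : (0 : ℝ) ≤ _)]
      · exact le_rfl
    · intro T hT hcard
      obtain ⟨v, hv, w, hw, hvw⟩ := Finset.one_lt_card.mp hcard
      obtain ⟨x, hx, hvx⟩ := hT.exists_adj hv hw hvw
      obtain ⟨y, hy, hyI⟩ : ∃ y ∈ T, y ∉ I := by
        by_contra! hT'
        exact hI v (hT' v hv) x (hT' x hx) hvx
      have := Finset.single_le_sum (fun i _ => (hc i).le) hy
      rw [if_neg hyI] at this
      linarith
    · rintro D ⟨-, hD⟩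
      have hDI : ∀ v ∈ D, v ∈ I := fun v hv => by
        by_contra hvI
        exact hD (IsTube.of_forall_adj hv fun w _ => hC v hvI w)
      rw [Finset.sum_congr rfl fun v hv => if_pos (hDI v hv), Finset.sum_const, nsmul_eq_mul,
        mul_one_div]
      have hle : (D.card : ℝ) ≤ Fintype.card V := by exact_mod_cast D.card_le_univ
      have : (D.card : ℝ) / (2 * (Fintype.card V + 1)) ≤ 1 / 2 := by
        rw [div_le_iff₀ hn]
        linarith
      linarith
end

section
/- Let n ≥ 4 and let G be the cycle graph on n vertices v₁, …, v_n (with edges {v_i, v_{i+1}} for 1 ≤ i ≤ n−1 together with {v_n, v₁}). Then G admits no admissible weight system. -/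
/-- The two endpoints of an edge form a tube. -/
lemma isTube_pair_of_adj {V : Type*} [DecidableEq V] {G : SimpleGraph V} {a b : V}
    (h : G.Adj a b) : IsTube G {a, b} := by
  unfold IsTube
  rw [Finset.coe_pair]
  exact SimpleGraph.induce_pair_connected_of_adj h

/-- Two distinct nonadjacent vertices form a non-tube. -/
lemma isNonTube_pair_of_not_adj {V : Type*} [DecidableEq V] {G : SimpleGraph V} {a b : V}
    (hab : a ≠ b) (h : ¬ G.Adj a b) : IsNonTube G {a, b} := by
  refine ⟨Finset.insert_nonempty _ _, fun hc => ?_⟩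
  have hr := hc.preconnected ⟨a, by simp⟩ ⟨b, by simp⟩
  obtain ⟨p⟩ := hr
  cases p with
  | nil => exact hab rfl
  | @cons _ v _ hadj _ =>
    obtain ⟨v, hv⟩ := v
    have hadj' : G.Adj a v := hadj
    rcases (by simpa using hv : v = a ∨ v = b) with rfl | rfl
    · exact G.irrefl hadj'
    · exact h hadj'

/-- A graph with an alternating 4-cycle (edges `ab`, `cd` and non-edges `ac`, `bd`)
admits no admissible weight system. -/
lemma not_isAdmissible_of_alternating {V : Type*} {G : SimpleGraph V} {a b c d : V}
    (hab : G.Adj a b) (hcd : G.Adj c d) (hac : a ≠ c) (hbd : b ≠ d)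
    (hac' : ¬ G.Adj a c) (hbd' : ¬ G.Adj b d) (w₀ : ℝ) (w : V → ℝ) :
    ¬ IsAdmissible G w₀ w := by
  classical
  rintro ⟨-, -, htube, hnon⟩
  have h₁ := htube _ (isTube_pair_of_adj hab) (Finset.card_pair hab.ne).ge
  have h₂ := htube _ (isTube_pair_of_adj hcd) (Finset.card_pair hcd.ne).ge
  have h₃ := hnon _ (isNonTube_pair_of_not_adj hac hac')
  have h₄ := hnon _ (isNonTube_pair_of_not_adj hbd hbd')
  rw [Finset.sum_pair hab.ne] at h₁
  rw [Finset.sum_pair hcd.ne] at h₂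
  rw [Finset.sum_pair hac] at h₃
  rw [Finset.sum_pair hbd] at h₄
  linarith

/-- The cycle graph on `n ≥ 4` vertices (with edges `{vᵢ, vᵢ₊₁}` cyclically,
i.e. indices taken modulo `n`) admits no admissible weight system. -/
theorem cycle_not_admissible (n : ℕ) (hn : 4 ≤ n) (G : SimpleGraph (Fin n))
    (hG : ∀ a b, G.Adj a b ↔
      (((a : ℕ) + 1) % n = (b : ℕ) ∨ ((b : ℕ) + 1) % n = (a : ℕ))) :
    ¬ ∃ (c₀ : ℝ) (c : Fin n → ℝ), IsAdmissible G c₀ c := by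
  rintro ⟨w₀, w, hw⟩
  have h1 : (0 + 1) % n = 1 := Nat.mod_eq_of_lt (by lia)
  have h2 : (1 + 1) % n = 2 := Nat.mod_eq_of_lt (by lia)
  have h3 : (2 + 1) % n = 3 := Nat.mod_eq_of_lt (by lia)
  have h4 : (3 + 1) % n ≠ 1 := by
    obtain rfl | h : n = 4 ∨ 4 < n := by lia
    · decide
    · rw [Nat.mod_eq_of_lt (by lia)]; decide
  refine not_isAdmissible_of_alternating (G := G) (a := ⟨0, by lia⟩) (b := ⟨1, by lia⟩)
    (c := ⟨2, by lia⟩) (d := ⟨3, by lia⟩) ?_ ?_ ?_ ?_ ?_ ?_ w₀ w hw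
  · exact (hG _ _).2 (Or.inl h1)
  · exact (hG _ _).2 (Or.inl h3)
  · simp
  · simp
  · rw [hG]
    lia
  · rw [hG]
    lia
end
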